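/- arXiv:2505.05362 — 5 statements merged into one kernel-verified Lean document; each statement's English description precedes it below -/
import Mathlib

section
/- (General behavior of a single-input neuron.) For every neuron N, identifier id : ℕ, input sequence inp : List Bool, and len : ℕ, if One_input(N, id, len) and is_initial(N, len), then either Output_N(inp, len) = inp ++ [false], or for all Booleans a₁, a₂ and lists l₁, l₂ : List Bool, Output_N(inp, len) = l₁ ++ [a₁; a₂] ++ l₂ implies a₁ = false or a₂ = false. -/
structure NeuronFeature where
  Id : ℕ
  Weights : ℕ → ℚ
  Leak_Factor : ℚ
  Tau : ℚ
  LeakRange : 0 ≤ Leak_Factor ∧ Leak_Factor ≤ 1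
  PosTau : 0 < Tau
  WRange : ∀ x, -1 ≤ Weights x ∧ Weights x ≤ 1
  WId : Weights Id = 0

structure Neuron where
  Output : List Bool
  CurPot : ℚ
  Feature : NeuronFeature
  CurPot_Output : decide (Feature.Tau ≤ CurPot) = Output.headD false

def potential (ws : ℕ → ℚ) (inp : ℕ → Bool) : ℕ → ℚ
  | 0 => 0
  | m + 1 => if inp m then potential ws inp m + ws m else potential ws inp m

def NextPotential (N : Neuron) (inp : ℕ → Bool) (len : ℕ) : ℚ :=
  if N.Feature.Tau ≤ N.CurPot then potential N.Feature.Weights inp len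
  else potential N.Feature.Weights inp len + N.Feature.Leak_Factor * N.CurPot

def NextNeuron (inp : ℕ → Bool) (len : ℕ) (N : Neuron) : Neuron :=
  ⟨decide (N.Feature.Tau ≤ NextPotential N inp len) :: N.Output,
   NextPotential N inp len, N.Feature, rfl⟩

def AfterNstepsNeuron (N : Neuron) (inp : List (ℕ → Bool)) (len : ℕ) : Neuron :=
  match inp with
  | [] => N
  | i :: tl => NextNeuron i len (AfterNstepsNeuron N tl len)

def SetNeuron (nf : NeuronFeature) : Neuron :=
  ⟨[false], 0, nf, by simp [not_le.mpr nf.PosTau]⟩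

def EquivFeature (nf1 nf2 : NeuronFeature) (len : ℕ) : Prop :=
  nf1.Id = nf2.Id ∧ (∀ id, id < len → nf1.Weights id = nf2.Weights id) ∧
    nf1.Leak_Factor = nf2.Leak_Factor ∧ nf1.Tau = nf2.Tau

def EquivNeuron (n1 n2 : Neuron) (len : ℕ) : Prop :=
  EquivFeature n1.Feature n2.Feature len ∧ n1.Output = n2.Output ∧ n1.CurPot = n2.CurPot

def is_initial_neuro (n : Neuron) (len : ℕ) : Prop :=
  ∃ nf : NeuronFeature, EquivNeuron n (SetNeuron nf) len

def One_Input_Or_Less (nf : NeuronFeature) (id len : ℕ) : Prop :=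
  id < len ∧ ∀ id', id ≠ id' → id' < len → nf.Weights id' = 0

def inpSI (inp : List Bool) : List (ℕ → Bool) :=
  inp.map (fun b _ => b)

structure NeuroCircuit where
  Time : ℕ
  ListNeuro : List Neuron
  SupplInput : ℕ
  IdNeuroDiff : ListNeuro.Pairwise (fun a b => a.Feature.Id ≠ b.Feature.Id)
  IdInfLen : ∀ n ∈ ListNeuro, n.Feature.Id < ListNeuro.length
  TimeNeuro : ∀ n ∈ ListNeuro, n.Output.length = Time + 1

def lenNC (nc : NeuroCircuit) : ℕ := nc.ListNeuro.length + nc.SupplInput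

def output_neuron_init (nc : NeuroCircuit) (id : ℕ) : List Bool :=
  match nc.ListNeuro.find? (fun x => x.Feature.Id == id) with
  | some x => x.Output
  | none => []

def NextNeuroInNC (nc : NeuroCircuit) (inp : ℕ → Bool) : Neuron → Neuron :=
  NextNeuron
    (fun x => if x < nc.ListNeuro.length then (output_neuron_init nc x).headD false else inp x)
    (lenNC nc)

def NextListNeuro (nc : NeuroCircuit) (inp : ℕ → Bool) : List Neuron :=
  nc.ListNeuro.map (NextNeuroInNC nc inp)

def NextStepC (nc : NeuroCircuit) (inp : ℕ → Bool) : NeuroCircuit where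
  Time := nc.Time + 1
  ListNeuro := NextListNeuro nc inp
  SupplInput := nc.SupplInput
  IdNeuroDiff := by
    unfold NextListNeuro
    exact nc.IdNeuroDiff.map _ (fun a b h => h)
  IdInfLen := by
    intro n hn
    unfold NextListNeuro at hn ⊢
    rw [List.mem_map] at hn
    obtain ⟨m, hm, rfl⟩ := hn
    simpa [NextNeuroInNC, NextNeuron] using nc.IdInfLen m hm
  TimeNeuro := by
    intro n hn
    unfold NextListNeuro at hn
    rw [List.mem_map] at hn
    obtain ⟨m, hm, rfl⟩ := hn
    simp [NextNeuroInNC, NextNeuron, nc.TimeNeuro m hm]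

def Nstepscircuit (nc : NeuroCircuit) (inp : List (ℕ → Bool)) : NeuroCircuit :=
  match inp with
  | [] => nc
  | h :: tl => NextStepC (Nstepscircuit nc tl) h

def output_neuron (nc : NeuroCircuit) (inp : List (ℕ → Bool)) (id : ℕ) : List Bool :=
  match (Nstepscircuit nc inp).ListNeuro.find? (fun x => x.Feature.Id == id) with
  | some x => x.Output
  | none => []

def curpot_neuron (nc : NeuroCircuit) (inp : List (ℕ → Bool)) (id : ℕ) : ℚ :=
  match (Nstepscircuit nc inp).ListNeuro.find? (fun x => x.Feature.Id == id) with
  | some x => x.CurPot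
  | none => 0

def is_initial_Cir (nc : NeuroCircuit) : Prop :=
  ∀ n ∈ nc.ListNeuro, ∃ nf : NeuronFeature, EquivNeuron n (SetNeuron nf) (lenNC nc)

def repeat_pattern (l : List Bool) (n : ℕ) : List Bool :=
  if l = [] then []
  else (List.range n).map (fun i => l.getD ((n - 1 - i) % l.length) false)

theorem pot_zero_aux (w : ℕ → ℚ) (b : Bool) (m : ℕ) (h : ∀ i, i < m → w i = 0) :
    potential w (fun _ => b) m = 0 := by
  induction m with
  | zero => rfl
  | succ k ih =>
    have h1 := ih (fun i hi => h i (by omega))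
    have h2 := h k (by omega)
    simp [potential, h1, h2]

theorem pot_one_aux (w : ℕ → ℚ) (b : Bool) (id m : ℕ) (hid : id < m)
    (h : ∀ i, id ≠ i → i < m → w i = 0) :
    potential w (fun _ => b) m = if b then w id else 0 := by
  induction m with
  | zero => omega
  | succ k ih =>
    by_cases hk : id = k
    · subst hk
      have h1 := pot_zero_aux w b id (fun i hi => h i (by omega) (by omega))
      simp [potential, h1]
    · have h1 := ih (by omega) (fun i hi hik => h i hi (by omega))
      have h2 := h k hk (by omega)
      simp [potential, h1, h2]

theorem feat_aux (N : Neuron) (inp : List (ℕ → Bool)) (len : ℕ) :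
    (AfterNstepsNeuron N inp len).Feature = N.Feature := by
  induction inp with
  | nil => rfl
  | cons a t ih => simpa [AfterNstepsNeuron, NextNeuron] using ih

theorem One_input_generic (N : Neuron) (id : ℕ) (inp : List Bool) (len : ℕ)
    (hone : One_Input_Or_Less N.Feature id len)
    (hinit : is_initial_neuro N len) :
    (AfterNstepsNeuron N (inpSI inp) len).Output = inp ++ [false] ∨
    (∀ (a₁ a₂ : Bool) (l₁ l₂ : List Bool),
      (AfterNstepsNeuron N (inpSI inp) len).Output = l₁ ++ [a₁, a₂] ++ l₂ →
      a₁ = false ∨ a₂ = false) := by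
  obtain ⟨nf, -, hout, hcur⟩ := hinit
  simp only [SetNeuron] at hout hcur
  have hpot := fun b => pot_one_aux N.Feature.Weights b id len hone.1 hone.2
  obtain ⟨hl0, hl1⟩ := N.Feature.LeakRange
  have hτ := N.Feature.PosTau
  rcases le_or_gt N.Feature.Tau (N.Feature.Weights id) with hw | hw
  · left
    suffices h : 0 ≤ (AfterNstepsNeuron N (inpSI inp) len).CurPot ∧
        (AfterNstepsNeuron N (inpSI inp) len).Output = inp ++ [false] from h.2
    induction inp with
    | nil => exact ⟨hcur.ge, hout⟩
    | cons b t ih =>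
      obtain ⟨hc, ho⟩ := ih
      have hf := feat_aux N (inpSI t) len
      simp only [inpSI, List.map_cons, AfterNstepsNeuron, NextNeuron] at *
      generalize AfterNstepsNeuron N (List.map (fun b _ => b) t) len = M at *
      have hP : NextPotential M (fun _ => b) len = if N.Feature.Tau ≤ M.CurPot then
          (if b then N.Feature.Weights id else 0)
          else (if b then N.Feature.Weights id else 0) + N.Feature.Leak_Factor * M.CurPot := by
        rw [NextPotential, hf, hpot]
      generalize NextPotential M (fun _ => b) len = P at *
      rw [hf, ho]
      have hm := mul_nonneg hl0 hc
      have hm2 := mul_le_mul_of_nonneg_right hl1 hc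
      constructor
      · rw [hP]; split_ifs <;> linarith
      · simp only [List.cons_append, List.cons.injEq, and_true]
        cases b <;> simp at hP ⊢ <;> split_ifs at hP <;> linarith
  · right
    have key : List.IsChain (fun a b => a = false ∨ b = false)
        (AfterNstepsNeuron N (inpSI inp) len).Output := by
      induction inp with
      | nil => simp [inpSI, AfterNstepsNeuron, hout]
      | cons b t ih =>
        have hf := feat_aux N (inpSI t) len
        simp only [inpSI, List.map_cons, AfterNstepsNeuron, NextNeuron] at *
        generalize AfterNstepsNeuron N (List.map (fun b _ => b) t) len = M at *
        have hM := M.CurPot_Output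
        rw [hf] at hM
        have hP : NextPotential M (fun _ => b) len = if N.Feature.Tau ≤ M.CurPot then
            (if b then N.Feature.Weights id else 0)
            else (if b then N.Feature.Weights id else 0) + N.Feature.Leak_Factor * M.CurPot := by
          rw [NextPotential, hf, hpot]
        generalize NextPotential M (fun _ => b) len = P at *
        rw [hf]
        cases hO : M.Output with
        | nil => simp
        | cons c l =>
          rw [hO] at ih hM
          refine List.isChain_cons_cons.2 ⟨?_, ih⟩
          cases c with
          | false => right; rfl
          | true =>
            left
            have hge : N.Feature.Tau ≤ M.CurPot := by simpa using hM
            rw [if_pos hge] at hP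
            cases b <;> simp at hP ⊢ <;> linarith
    intro a₁ a₂ l₁ l₂ h
    rw [h, List.append_assoc] at key
    exact (List.isChain_cons_cons.1 (List.isChain_append.1 key).2.1).1
end

section
/- (Spike decreasing.) For every neuron N, identifier id : ℕ, input sequence inp : List Bool, and len : ℕ, if One_input(N, id, len) and is_initial(N, len), then the number of occurrences of true in Output_N(inp, len) is at most the number of occurrences of true in inp. -/
theorem potential_false_aux (ws : ℕ → ℚ) (len : ℕ) : potential ws (fun _ => false) len = 0 := by
  induction len with
  | zero => rfl
  | succ m ih => simp [potential, ih]

theorem nextPotential_false_aux (N : Neuron) (len : ℕ) :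
    NextPotential N (fun _ => false) len < N.Feature.Tau := by
  have h0 := N.Feature.PosTau
  obtain ⟨h1, h2⟩ := N.Feature.LeakRange
  unfold NextPotential
  rw [potential_false_aux]
  split_ifs with h
  · exact h0
  · rw [not_le] at h
    rcases le_total 0 N.CurPot with hc | hc
    · nlinarith
    · nlinarith

theorem Spike_Decreasing (N : Neuron) (id : ℕ) (inp : List Bool) (len : ℕ)
    (hone : One_Input_Or_Less N.Feature id len)
    (hinit : is_initial_neuro N len) :
    (AfterNstepsNeuron N (inpSI inp) len).Output.count true ≤ inp.count true := by 
  obtain ⟨nf, -, ho, -⟩ := hinit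
  clear hone
  induction inp with
  | nil => simp [inpSI, AfterNstepsNeuron, ho, SetNeuron]
  | cons b tl ih =>
    have e : AfterNstepsNeuron N (inpSI (b :: tl)) len
        = NextNeuron (fun _ => b) len (AfterNstepsNeuron N (inpSI tl) len) := rfl
    rw [e]
    generalize AfterNstepsNeuron N (inpSI tl) len = M at ih
    unfold NextNeuron
    cases b with
    | false =>
      have h := nextPotential_false_aux M len
      simpa [List.count_cons, not_le.mpr h] using ih
    | true =>
      simp only [List.count_cons]
      split_ifs <;> simp_all <;> omega
end

section
/- (Delayer effect, internal source.) For every neuronal circuit NC, neurons N₁ and N₂, and input list inp : List (ℕ → Bool), if is_initial_Cir(NC), N₁ and N₂ are members of ListNeuro(NC), One_input(N₁, id_{N₂}, len(NC)), and τ_{N₁} ≤ w_{N₁}(id_{N₂}), then output_NC(N₁, inp) = tail(output_NC(N₂, inp)) ++ [false]. -/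
theorem aux_find (l : List Neuron) (n : Neuron)
    (hd : l.Pairwise (fun a b => a.Feature.Id ≠ b.Feature.Id)) (hn : n ∈ l) :
    l.find? (fun x => x.Feature.Id == n.Feature.Id) = some n := by
  induction l with
  | nil => simp at hn
  | cons a t ih =>
    rw [List.pairwise_cons] at hd
    rcases List.mem_cons.mp hn with rfl | h
    · simp
    · rw [List.find?_cons_of_neg]
      · exact ih hd.2 h
      · simpa using hd.1 n h

theorem aux_pot (w : ℕ → ℚ) (inp : ℕ → Bool) (id len : ℕ)
    (h : ∀ id', id ≠ id' → id' < len → w id' = 0) :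
    potential w inp len = if id < len ∧ inp id = true then w id else 0 := by
  induction len with
  | zero => simp [potential]
  | succ m ih =>
    have ih' := ih (fun id' h1 h2 => h id' h1 (by omega))
    unfold potential
    rw [ih']
    by_cases hm : id = m
    · subst hm
      simp
    · have h0 := h m hm (by omega)
      have : id < m + 1 ↔ id < m := by omega
      simp [h0, this]

theorem aux_len (NC : NeuroCircuit) (inp : List (ℕ → Bool)) :
    lenNC (Nstepscircuit NC inp) = lenNC NC := by
  induction inp with
  | nil => rfl
  | cons i t ih =>
    rw [← ih]
    simp [Nstepscircuit, lenNC, NextStepC, NextListNeuro]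

theorem aux_inv (NC : NeuroCircuit) (N₁ N₂ : Neuron)
    (inp : List (ℕ → Bool))
    (hinit : is_initial_Cir NC)
    (hmem1 : N₁ ∈ NC.ListNeuro) (hmem2 : N₂ ∈ NC.ListNeuro)
    (hone : One_Input_Or_Less N₁.Feature N₂.Feature.Id (lenNC NC))
    (hw : N₁.Feature.Tau ≤ N₁.Feature.Weights N₂.Feature.Id) :
    ∃ n₁ ∈ (Nstepscircuit NC inp).ListNeuro, ∃ n₂ ∈ (Nstepscircuit NC inp).ListNeuro,
      n₁.Feature = N₁.Feature ∧ n₂.Feature = N₂.Feature ∧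
      n₁.Output = n₂.Output.tail ++ [false] ∧
      (n₁.CurPot < N₁.Feature.Tau → n₁.CurPot = 0) := by
  induction inp with
  | nil =>
    obtain ⟨f1, -, h1, h1'⟩ := hinit N₁ hmem1
    obtain ⟨f2, -, h2, -⟩ := hinit N₂ hmem2
    refine ⟨N₁, hmem1, N₂, hmem2, rfl, rfl, ?_, fun _ => ?_⟩
    · rw [h1, h2]; rfl
    · rw [h1']; rfl
  | cons i t ih =>
    obtain ⟨n₁, m1, n₂, m2, e1, e2, ho, hc⟩ := ih
    have hlen := aux_len NC t
    simp only [Nstepscircuit]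
    generalize Nstepscircuit NC t = C at *
    refine ⟨NextNeuroInNC C i n₁, List.mem_map_of_mem m1,
      NextNeuroInNC C i n₂, List.mem_map_of_mem m2, e1, e2, ?_⟩
    have hlt : N₂.Feature.Id < C.ListNeuro.length := e2 ▸ C.IdInfLen n₂ m2
    have hout : output_neuron_init C N₂.Feature.Id = n₂.Output := by
      unfold output_neuron_init
      rw [← e2, aux_find _ n₂ C.IdNeuroDiff m2]
    have hne : n₂.Output ≠ [] := by
      intro h
      have := C.TimeNeuro n₂ m2
      simp [h] at this
    have hτ := N₁.Feature.PosTau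
    have key : NextPotential n₁ (fun x => if x < C.ListNeuro.length then
        (output_neuron_init C x).headD false else i x) (lenNC C) =
        if n₂.Output.headD false = true then N₁.Feature.Weights N₂.Feature.Id else 0 := by
      unfold NextPotential
      rw [e1, aux_pot _ _ N₂.Feature.Id (lenNC C) (by rw [hlen]; exact hone.2)]
      have hl : N₂.Feature.Id < lenNC C := by rw [hlen]; exact hone.1
      simp only [hl, hlt, hout, if_true, true_and]
      split_ifs with h1 <;> first | rfl | (rw [hc (not_le.mp h1)]; simp)
    simp only [NextNeuroInNC, NextNeuron, key, e1, ho, List.tail_cons]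
    obtain ⟨b, l, hbl⟩ := List.exists_cons_of_ne_nil hne
    rw [hbl]
    cases b
    · simp [hτ]
    · simp [hw, not_lt.mpr hw]

theorem One_Input_NC_delay_Int (NC : NeuroCircuit) (N₁ N₂ : Neuron)
    (inp : List (ℕ → Bool))
    (hinit : is_initial_Cir NC)
    (hmem1 : N₁ ∈ NC.ListNeuro) (hmem2 : N₂ ∈ NC.ListNeuro)
    (hone : One_Input_Or_Less N₁.Feature N₂.Feature.Id (lenNC NC))
    (hw : N₁.Feature.Tau ≤ N₁.Feature.Weights N₂.Feature.Id) :
    output_neuron NC inp N₁.Feature.Id =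
      (output_neuron NC inp N₂.Feature.Id).tail ++ [false] := by 
  obtain ⟨n₁, m1, n₂, m2, e1, e2, ho, -⟩ := aux_inv NC N₁ N₂ inp hinit hmem1 hmem2 hone hw
  unfold output_neuron
  rw [← e1, ← e2, aux_find _ n₁ (Nstepscircuit NC inp).IdNeuroDiff m1,
    aux_find _ n₂ (Nstepscircuit NC inp).IdNeuroDiff m2]
  exact ho
end

section
/- (Positive loop with all-zero input.) For every neuronal circuit NC and input sequence inp : List Bool, if PositiveLoop(NC), is_initial_Cir(NC), every element of inp equals false, w_{N_0}(2) ≥ τ_{N_0}, w_{N_0}(1) ≥ τ_{N_0}, and w_{N_1}(0) ≥ τ_{N_1}, then output_NC(N_0, inp) = repeat(false, length(inp) + 1) and output_NC(N_1, inp) = repeat(false, length(inp) + 1). -/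
def PositiveLoop (c : NeuroCircuit) : Prop :=
  c.SupplInput = 1 ∧ c.ListNeuro.length = 2 ∧
  (∀ n ∈ c.ListNeuro, n.Feature.Id = 0 →
    0 < n.Feature.Weights 1 ∧ 0 < n.Feature.Weights 2) ∧
  (∀ n ∈ c.ListNeuro, n.Feature.Id = 1 →
    0 < n.Feature.Weights 0 ∧ n.Feature.Weights 2 = 0)

theorem potential_all_false (ws : ℕ → ℚ) (f : ℕ → Bool) (h : ∀ x, f x = false) (m : ℕ) :
    potential ws f m = 0 := by
  induction m with
  | zero => rfl
  | succ m ih => simp [potential, h, ih]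

theorem steps_inv (NC : NeuroCircuit) (hinit : is_initial_Cir NC) (inp : List Bool)
    (hz : ∀ b ∈ inp, b = false) :
    (Nstepscircuit NC (inpSI inp)).ListNeuro.length = NC.ListNeuro.length ∧
    ∀ n ∈ (Nstepscircuit NC (inpSI inp)).ListNeuro,
      n.CurPot = 0 ∧ n.Output = List.replicate (inp.length + 1) false := by
  induction inp with
  | nil =>
    refine ⟨rfl, fun n hn => ?_⟩
    obtain ⟨nf, _, h2, h3⟩ := hinit n hn
    exact ⟨h3, h2⟩
  | cons b tl ih =>
    obtain ⟨hl, ih⟩ := ih (fun b hb => hz b (List.mem_cons_of_mem _ hb))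
    have hb : b = false := hz b List.mem_cons_self
    subst hb
    change (NextStepC (Nstepscircuit NC (inpSI tl)) (fun _ => false)).ListNeuro.length = _ ∧
      ∀ n ∈ (NextStepC (Nstepscircuit NC (inpSI tl)) (fun _ => false)).ListNeuro, _
    generalize Nstepscircuit NC (inpSI tl) = C at hl ih
    refine ⟨by simpa [NextStepC, NextListNeuro] using hl, fun n hn => ?_⟩
    simp only [NextStepC, NextListNeuro, List.mem_map] at hn
    obtain ⟨m, hm, rfl⟩ := hn
    obtain ⟨h1, h2⟩ := ih m hm
    have hf : ∀ x, (if x < C.ListNeuro.length then (output_neuron_init C x).headD false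
        else (fun _ : ℕ => false) x) = false := by
      intro x
      split
      · unfold output_neuron_init
        split
        · next y hy =>
          rw [(ih y (List.mem_of_find?_eq_some hy)).2]
          rfl
        · rfl
      · rfl
    have hp : NextPotential m (fun x => if x < C.ListNeuro.length then
        (output_neuron_init C x).headD false else (fun _ : ℕ => false) x) (lenNC C) = 0 := by
      unfold NextPotential
      rw [potential_all_false _ _ hf, h1]
      simp
    refine ⟨hp, ?_⟩
    simp only [NextNeuroInNC, NextNeuron]
    rw [hp, h2]
    simp [List.replicate_succ, m.Feature.PosTau]

theorem exists_id (C : NeuroCircuit) (h : C.ListNeuro.length = 2) (k : ℕ) (hk : k < 2) :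
    ∃ n ∈ C.ListNeuro, n.Feature.Id = k := by
  have h1 := C.IdNeuroDiff
  have h2 := C.IdInfLen
  rw [h] at h2
  obtain ⟨a, b, hab⟩ := List.length_eq_two.mp h
  rw [hab] at h1 h2 ⊢
  simp at h1 h2 ⊢
  omega

theorem output_false (NC : NeuroCircuit) (hinit : is_initial_Cir NC) (inp : List Bool)
    (hz : ∀ b ∈ inp, b = false) (h : NC.ListNeuro.length = 2) (k : ℕ) (hk : k < 2) :
    output_neuron NC (inpSI inp) k = List.replicate (inp.length + 1) false := by
  obtain ⟨hl, hi⟩ := steps_inv NC hinit inp hz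
  obtain ⟨n, hn, hid⟩ := exists_id _ (hl.trans h) k hk
  unfold output_neuron
  split
  · next y hy => exact (hi y (List.mem_of_find?_eq_some hy)).2
  · next hy =>
    have := List.find?_eq_none.mp hy n hn
    simp [hid] at this

theorem PL_Amplifier_input_false (NC : NeuroCircuit) (inp : List Bool)
    (hpl : PositiveLoop NC)
    (hinit : is_initial_Cir NC)
    (hw0 : ∀ n ∈ NC.ListNeuro, n.Feature.Id = 0 →
      n.Feature.Tau ≤ n.Feature.Weights 2 ∧ n.Feature.Tau ≤ n.Feature.Weights 1)
    (hw1 : ∀ n ∈ NC.ListNeuro, n.Feature.Id = 1 →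
      n.Feature.Tau ≤ n.Feature.Weights 0)
    (hz : ∀ b ∈ inp, b = false) :
    output_neuron NC (inpSI inp) 0 = List.replicate (inp.length + 1) false ∧
    output_neuron NC (inpSI inp) 1 = List.replicate (inp.length + 1) false := 
  ⟨output_false NC hinit inp hz hpl.2.1 0 (by norm_num),
    output_false NC hinit inp hz hpl.2.1 1 (by norm_num)⟩
end

section
/- (Negative loop oscillation, leak-bounded case.) For every neuronal circuit NC and input sequence inp : List Bool, if NegativeLoop(NC), is_initial_Cir(NC), every element of inp equals true, w_{N_0}(2) ≥ τ_{N_0}, w_{N_1}(0) ≥ τ_{N_1}, w_{N_0}(1) + w_{N_0}(2) ≥ 0, and (1 + lk_{N_0}) · (w_{N_0}(1) + w_{N_0}(2)) < τ_{N_0}, then output_NC(N_0, inp) = repeat_pattern([false; true; true; false], length(inp) + 1) and output_NC(N_1, inp) = repeat_pattern([false; false; true; true], length(inp) + 1). -/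
def NegativeLoop (c : NeuroCircuit) : Prop :=
  c.SupplInput = 1 ∧ c.ListNeuro.length = 2 ∧
  (∀ n ∈ c.ListNeuro, n.Feature.Id = 0 →
    n.Feature.Weights 1 < 0 ∧ 0 < n.Feature.Weights 2) ∧
  (∀ n ∈ c.ListNeuro, n.Feature.Id = 1 →
    0 < n.Feature.Weights 0 ∧ n.Feature.Weights 2 = 0)

theorem repeat_pattern_succ (l : List Bool) (hl : l ≠ []) (n : ℕ) :
    repeat_pattern l (n + 1) = l.getD (n % l.length) false :: repeat_pattern l n := by
  unfold repeat_pattern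
  rw [if_neg hl, if_neg hl, List.range_succ_eq_map]
  simp only [List.map_cons, List.map_map]
  congr 1
  apply List.map_congr_left
  intro i _
  simp only [Function.comp]
  congr 2
  omega

theorem find_next (nc : NeuroCircuit) (i : ℕ → Bool) (k : ℕ) (n : Neuron)
    (h : nc.ListNeuro.find? (fun x => x.Feature.Id == k) = some n) :
    (NextStepC nc i).ListNeuro.find? (fun x => x.Feature.Id == k) =
      some (NextNeuroInNC nc i n) := by
  simp only [NextStepC, NextListNeuro, List.find?_map]
  have : ((fun x : Neuron => x.Feature.Id == k) ∘ NextNeuroInNC nc i) =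
      (fun x : Neuron => x.Feature.Id == k) := rfl
  rw [this, h]; rfl

/-- State conditions by time modulo 4. -/
def Phase (F0 F1 : NeuronFeature) (t : ℕ) (p0 p1 : ℚ) : Prop :=
  (t % 4 = 0 ∧ 0 ≤ p0 ∧ p0 < F0.Tau ∧ p1 = 0) ∨
  (t % 4 = 1 ∧ F0.Tau ≤ p0 ∧ p1 = 0) ∨
  (t % 4 = 2 ∧ F0.Tau ≤ p0 ∧ F1.Tau ≤ p1) ∨
  (t % 4 = 3 ∧ p0 = F0.Weights 1 + F0.Weights 2 ∧ F1.Tau ≤ p1)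

theorem step_pot (nc : NeuroCircuit) (hs : nc.SupplInput = 1) (hl : nc.ListNeuro.length = 2)
    (n0 n1 : Neuron)
    (h0 : nc.ListNeuro.find? (fun x => x.Feature.Id == 0) = some n0)
    (h1 : nc.ListNeuro.find? (fun x => x.Feature.Id == 1) = some n1) (w : ℕ → ℚ) :
    potential w (fun x => if x < nc.ListNeuro.length then
      (output_neuron_init nc x).headD false else true) (lenNC nc) =
    (if n0.Feature.Tau ≤ n0.CurPot then w 0 else 0) +
      (if n1.Feature.Tau ≤ n1.CurPot then w 1 else 0) + w 2 := by
  have e0 : (output_neuron_init nc 0).headD false = decide (n0.Feature.Tau ≤ n0.CurPot) := by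
    rw [n0.CurPot_Output]; simp only [output_neuron_init, h0]
  have e1 : (output_neuron_init nc 1).headD false = decide (n1.Feature.Tau ≤ n1.CurPot) := by
    rw [n1.CurPot_Output]; simp only [output_neuron_init, h1]
  have e : lenNC nc = 3 := by simp [lenNC, hs, hl]
  rw [e]
  simp only [potential, hl, e0, e1]
  norm_num
  split_ifs <;> simp

theorem main_inv (NC : NeuroCircuit) (hs : NC.SupplInput = 1) (hl : NC.ListNeuro.length = 2)
    (m0 m1 : Neuron)
    (h0 : NC.ListNeuro.find? (fun x => x.Feature.Id == 0) = some m0)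
    (h1 : NC.ListNeuro.find? (fun x => x.Feature.Id == 1) = some m1)
    (o0 : m0.Output = [false]) (o1 : m1.Output = [false])
    (c0 : m0.CurPot = 0) (c1 : m1.CurPot = 0)
    (z0 : m0.Feature.Weights 0 = 0) (z1 : m1.Feature.Weights 1 = 0)
    (z2 : m1.Feature.Weights 2 = 0)
    (hb : m0.Feature.Tau ≤ m0.Feature.Weights 2)
    (hc : m1.Feature.Tau ≤ m1.Feature.Weights 0)
    (hs0 : 0 ≤ m0.Feature.Weights 1 + m0.Feature.Weights 2)
    (hs1 : (1 + m0.Feature.Leak_Factor) * (m0.Feature.Weights 1 + m0.Feature.Weights 2) <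
        m0.Feature.Tau)
    (inp : List Bool) (ht : ∀ b ∈ inp, b = true) :
    (Nstepscircuit NC (inpSI inp)).SupplInput = 1 ∧
    (Nstepscircuit NC (inpSI inp)).ListNeuro.length = 2 ∧
    ∃ n0 n1 : Neuron,
      (Nstepscircuit NC (inpSI inp)).ListNeuro.find? (fun x => x.Feature.Id == 0) = some n0 ∧
      (Nstepscircuit NC (inpSI inp)).ListNeuro.find? (fun x => x.Feature.Id == 1) = some n1 ∧
      n0.Feature = m0.Feature ∧ n1.Feature = m1.Feature ∧
      n0.Output = repeat_pattern [false, true, true, false] (inp.length + 1) ∧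
      n1.Output = repeat_pattern [false, false, true, true] (inp.length + 1) ∧
      Phase m0.Feature m1.Feature inp.length n0.CurPot n1.CurPot := by
  have t0 := m0.Feature.PosTau
  have t1 := m1.Feature.PosTau
  induction inp with
  | nil =>
    refine ⟨hs, hl, m0, m1, h0, h1, rfl, rfl, ?_, ?_, ?_⟩
    · rw [o0]; rfl
    · rw [o1]; rfl
    · left; simp [c0, c1, t0]
  | cons b tl ih =>
    have hbt : b = true := ht b (by simp)
    subst hbt
    obtain ⟨is, il, n0, n1, f0, f1, g0, g1, p0, p1, ph⟩ :=
      ih (fun b hb => ht b (by simp [hb]))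
    have hN : Nstepscircuit NC (inpSI (true :: tl)) =
      NextStepC (Nstepscircuit NC (inpSI tl)) (fun _ => true) := rfl
    rw [hN]
    generalize Nstepscircuit NC (inpSI tl) = C at *
    have hp := step_pot C is il n0 n1 f0 f1
    refine ⟨is, by simpa [NextStepC, NextListNeuro] using il, _, _, find_next C _ 0 n0 f0,
      find_next C _ 1 n1 f1, g0, g1, ?_⟩
    rw [List.length_cons, repeat_pattern_succ _ (by simp) (tl.length + 1),
      repeat_pattern_succ _ (by simp) (tl.length + 1)]
    simp only [NextNeuroInNC, NextNeuron, NextPotential, hp, g0, g1, p0, p1, z0, z1, z2,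
      List.cons.injEq, and_true]
    have k0 := m0.Feature.LeakRange.1
    generalize m0.Feature.Leak_Factor = l0 at *
    have hls := mul_nonneg k0 hs0
    rcases ph with ⟨hm, a1, a2, a3⟩ | ⟨hm, a1, a3⟩ | ⟨hm, a1, a3⟩ | ⟨hm, a1, a3⟩
    · have hm' : (tl.length + 1) % 4 = 1 := by omega
      have := mul_nonneg k0 a1
      simp [Phase, hm', not_le.mpr a2, a3, not_le.mpr t1]
      linarith
    · have hm' : (tl.length + 1) % 4 = 2 := by omega
      simp [Phase, hm', a1, a3, not_le.mpr t1, hb, hc]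
    · have hm' : (tl.length + 1) % 4 = 3 := by omega
      simp [Phase, hm', a1, a3, hc]
      linarith
    · have hm' : (tl.length + 1) % 4 = 0 := by omega
      have q : n0.CurPot < m0.Feature.Tau := by linarith
      simp [Phase, hm', not_le.mpr q, a3, not_le.mpr t1]
      rw [a1]
      refine ⟨?_, ?_, ?_⟩ <;> linarith

theorem NL_Output_Oscil_case2 (NC : NeuroCircuit) (inp : List Bool)
    (hnl : NegativeLoop NC)
    (hinit : is_initial_Cir NC)
    (ht : ∀ b ∈ inp, b = true)
    (hw02 : ∀ n ∈ NC.ListNeuro, n.Feature.Id = 0 →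
      n.Feature.Tau ≤ n.Feature.Weights 2)
    (hw10 : ∀ n ∈ NC.ListNeuro, n.Feature.Id = 1 →
      n.Feature.Tau ≤ n.Feature.Weights 0)
    (hsum : ∀ n ∈ NC.ListNeuro, n.Feature.Id = 0 →
      0 ≤ n.Feature.Weights 1 + n.Feature.Weights 2 ∧
      (1 + n.Feature.Leak_Factor) * (n.Feature.Weights 1 + n.Feature.Weights 2) <
        n.Feature.Tau) :
    output_neuron NC (inpSI inp) 0 =
      repeat_pattern [false, true, true, false] (inp.length + 1) ∧
    output_neuron NC (inpSI inp) 1 =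
      repeat_pattern [false, false, true, true] (inp.length + 1) := by
  obtain ⟨hs, hl, -, hz⟩ := hnl
  have key : ∃ m0 m1 : Neuron, m0 ∈ NC.ListNeuro ∧ m1 ∈ NC.ListNeuro ∧
      m0.Feature.Id = 0 ∧ m1.Feature.Id = 1 ∧
      NC.ListNeuro.find? (fun x => x.Feature.Id == 0) = some m0 ∧
      NC.ListNeuro.find? (fun x => x.Feature.Id == 1) = some m1 := by
    have hd := NC.IdNeuroDiff
    have hi := NC.IdInfLen
    obtain ⟨x, y, hxy⟩ := List.length_eq_two.mp hl
    rw [hxy] at hd hi ⊢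
    have hx := hi x (by simp)
    have hy := hi y (by simp)
    simp at hd hx hy
    have : (x.Feature.Id = 0 ∧ y.Feature.Id = 1) ∨ (x.Feature.Id = 1 ∧ y.Feature.Id = 0) := by
      omega
    rcases this with ⟨h, h'⟩ | ⟨h, h'⟩
    · exact ⟨x, y, by simp, by simp, h, h', by simp [List.find?, h], by simp [List.find?, h, h']⟩
    · exact ⟨y, x, by simp, by simp, h', h, by simp [List.find?, h, h'], by simp [List.find?, h]⟩
  obtain ⟨m0, m1, i0, i1, d0, d1, h0, h1⟩ := key
  obtain ⟨nf0, -, q0, r0⟩ := hinit m0 i0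
  obtain ⟨nf1, -, q1, r1⟩ := hinit m1 i1
  have z0 := m0.Feature.WId
  rw [d0] at z0
  have z1 := m1.Feature.WId
  rw [d1] at z1
  obtain ⟨-, -, n0, n1, f0, f1, -, -, p0, p1, -⟩ := main_inv NC hs hl m0 m1 h0 h1 q0 q1 r0 r1 z0 z1
    (hz m1 i1 d1).2 (hw02 m0 i0 d0) (hw10 m1 i1 d1) (hsum m0 i0 d0).1 (hsum m0 i0 d0).2 inp ht
  simp only [output_neuron, f0, f1]
  exact ⟨p0, p1⟩
end
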